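/- arXiv:2302.03461 — 2 statements merged into one kernel-verified Lean document; each statement's English description precedes it below -/
import Mathlib

section
/- Let n ≥ 3 be an integer and set σ = 40n³. Let u, v, u', v' be four pairwise distinct points of ℝ² all of whose coordinates are integers in {0, 1, …, n−1}, and assume that the segments [u, v] and [u', v'] are disjoint (have empty intersection). Then no point x ∈ ℝ² is simultaneously at Euclidean distance at most 2 from the segment [σ·u, σ·v] and at Euclidean distance at most 2 from the segment [σ·u', σ·v']; that is, the margins at distance 2 of the two scaled segments are disjoint. -/
theorem aux_one (A B C : ℤ) (s t : ℝ) (hs : 0 ≤ s) (hs1 : s ≤ 1) (ht : 0 ≤ t) (ht1 : t ≤ 1)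
    (h : |(A : ℝ) + s * B - t * C| < 1) :
    ∃ s' t' : ℝ, 0 ≤ s' ∧ s' ≤ 1 ∧ 0 ≤ t' ∧ t' ≤ 1 ∧ (A : ℝ) + s' * B - t' * C = 0 := by
  rw [abs_lt] at h
  obtain ⟨hl, hr⟩ := h
  have low : ∃ a b : ℤ, 0 ≤ a ∧ a ≤ 1 ∧ 0 ≤ b ∧ b ≤ 1 ∧ A + a * B - b * C ≤ 0 := by
    have key : ∀ a b : ℤ, (a : ℝ) * B ≤ s * B → (t * C : ℝ) ≤ b * C → A + a * B - b * C ≤ 0 := by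
      intro a b h1 h2
      have : ((A + a * B - b * C : ℤ) : ℝ) < ((1 : ℤ) : ℝ) := by push_cast; linarith
      have := Int.cast_lt.mp this
      omega
    rcases le_total 0 (B : ℝ) with hB | hB <;> rcases le_total 0 (C : ℝ) with hC | hC
    · exact ⟨0, 1, by norm_num, by norm_num, by norm_num, by norm_num,
        key 0 1 (by push_cast; nlinarith) (by push_cast; nlinarith)⟩
    · exact ⟨0, 0, by norm_num, by norm_num, by norm_num, by norm_num,
        key 0 0 (by push_cast; nlinarith) (by push_cast; nlinarith)⟩
    · exact ⟨1, 1, by norm_num, by norm_num, by norm_num, by norm_num,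
        key 1 1 (by push_cast; nlinarith) (by push_cast; nlinarith)⟩
    · exact ⟨1, 0, by norm_num, by norm_num, by norm_num, by norm_num,
        key 1 0 (by push_cast; nlinarith) (by push_cast; nlinarith)⟩
  have high : ∃ a b : ℤ, 0 ≤ a ∧ a ≤ 1 ∧ 0 ≤ b ∧ b ≤ 1 ∧ 0 ≤ A + a * B - b * C := by
    have key : ∀ a b : ℤ, s * B ≤ (a : ℝ) * B → (b * C : ℝ) ≤ t * C → 0 ≤ A + a * B - b * C := by
      intro a b h1 h2
      have : ((-1 : ℤ) : ℝ) < ((A + a * B - b * C : ℤ) : ℝ) := by push_cast; linarith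
      have := Int.cast_lt.mp this
      omega
    rcases le_total 0 (B : ℝ) with hB | hB <;> rcases le_total 0 (C : ℝ) with hC | hC
    · exact ⟨1, 0, by norm_num, by norm_num, by norm_num, by norm_num,
        key 1 0 (by push_cast; nlinarith) (by push_cast; nlinarith)⟩
    · exact ⟨1, 1, by norm_num, by norm_num, by norm_num, by norm_num,
        key 1 1 (by push_cast; nlinarith) (by push_cast; nlinarith)⟩
    · exact ⟨0, 0, by norm_num, by norm_num, by norm_num, by norm_num,
        key 0 0 (by push_cast; nlinarith) (by push_cast; nlinarith)⟩
    · exact ⟨0, 1, by norm_num, by norm_num, by norm_num, by norm_num,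
        key 0 1 (by push_cast; nlinarith) (by push_cast; nlinarith)⟩
  obtain ⟨a, b, a0, a1, b0, b1, hab⟩ := low
  obtain ⟨c, d, c0, c1, d0, d1, hcd⟩ := high
  have a0' : (0 : ℝ) ≤ a := by exact_mod_cast a0
  have a1' : (a : ℝ) ≤ 1 := by exact_mod_cast a1
  have b0' : (0 : ℝ) ≤ b := by exact_mod_cast b0
  have b1' : (b : ℝ) ≤ 1 := by exact_mod_cast b1
  have c0' : (0 : ℝ) ≤ c := by exact_mod_cast c0
  have c1' : (c : ℝ) ≤ 1 := by exact_mod_cast c1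
  have d0' : (0 : ℝ) ≤ d := by exact_mod_cast d0
  have d1' : (d : ℝ) ≤ 1 := by exact_mod_cast d1
  have hab' : (A + a * B - b * C : ℝ) ≤ 0 := by exact_mod_cast hab
  have hcd' : (0 : ℝ) ≤ A + c * B - d * C := by exact_mod_cast hcd
  have ivt := intermediate_value_Icc (a := (0 : ℝ)) (b := 1) zero_le_one
    (f := fun r : ℝ => (A : ℝ) + (a + r * (c - a)) * B - (b + r * (d - b)) * C)
    (by fun_prop)
  obtain ⟨r, ⟨r0, r1⟩, hr⟩ := ivt (show (0 : ℝ) ∈ _ from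
    ⟨by simpa using hab', by simpa using hcd'⟩)
  refine ⟨a + r * (c - a), b + r * (d - b), ?_, ?_, ?_, ?_, hr⟩ <;> nlinarith

theorem aux_core (a0 a1 d0 d1 e0 e1 : ℤ) (s t w0 w1 N : ℝ)
    (hs : 0 ≤ s) (hs1 : s ≤ 1) (ht : 0 ≤ t) (ht1 : t ≤ 1)
    (hd0 : |(d0 : ℝ)| ≤ N) (hd1 : |(d1 : ℝ)| ≤ N) (he0 : |(e0 : ℝ)| ≤ N) (he1 : |(e1 : ℝ)| ≤ N)
    (hw0 : |w0| * N < 1 / 2) (hw1 : |w1| * N < 1 / 2)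
    (h0 : (a0 : ℝ) + s * d0 - t * e0 = w0) (h1 : (a1 : ℝ) + s * d1 - t * e1 = w1)
    (hd : ¬ (d0 = 0 ∧ d1 = 0)) (he : ¬ (e0 = 0 ∧ e1 = 0)) :
    ∃ s' t' : ℝ, 0 ≤ s' ∧ s' ≤ 1 ∧ 0 ≤ t' ∧ t' ≤ 1 ∧
      (a0 : ℝ) + s' * d0 - t' * e0 = 0 ∧ (a1 : ℝ) + s' * d1 - t' * e1 = 0 := by
  have small : ∀ x y : ℝ, |x| ≤ N → |y| ≤ N → |w0 * x + w1 * y| < 1 := by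
    intro x y hx hy
    have h1 := abs_add_le (w0 * x) (w1 * y)
    rw [abs_mul, abs_mul] at h1
    have h2 := mul_le_mul_of_nonneg_left hx (abs_nonneg w0)
    have h3 := mul_le_mul_of_nonneg_left hy (abs_nonneg w1)
    linarith
  have se : |(((a0 * e1 - a1 * e0 : ℤ)) : ℝ) + s * ((d0 * e1 - d1 * e0 : ℤ) : ℝ)
      - t * ((0 : ℤ) : ℝ)| < 1 := by
    have := small e1 (-e0) he1 (by rwa [abs_neg])
    rw [← h0, ← h1] at this
    convert this using 2
    push_cast; ring
  have sd : |(((a0 * d1 - a1 * d0 : ℤ)) : ℝ) + s * ((0 : ℤ) : ℝ)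
      - t * ((e0 * d1 - e1 * d0 : ℤ) : ℝ)| < 1 := by
    have := small d1 (-d0) hd1 (by rwa [abs_neg])
    rw [← h0, ← h1] at this
    convert this using 2
    push_cast; ring
  have sp : |(((a0 * d0 + a1 * d1 : ℤ)) : ℝ) + s * ((d0 * d0 + d1 * d1 : ℤ) : ℝ)
      - t * ((e0 * d0 + e1 * d1 : ℤ) : ℝ)| < 1 := by
    have := small d0 d1 hd0 hd1
    rw [← h0, ← h1] at this
    convert this using 2
    push_cast; ring
  by_cases hD : d0 * e1 - d1 * e0 = 0
  · have hD' : e0 * d1 - e1 * d0 = 0 := by linarith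
    rw [hD'] at sd
    simp only [Int.cast_zero, mul_zero, add_zero, sub_zero] at sd
    have z : a0 * d1 - a1 * d0 = 0 := by
      rw [← Int.abs_lt_one_iff]; exact_mod_cast sd
    obtain ⟨s', t', q1, q2, q3, q4, q⟩ := aux_one _ _ _ s t hs hs1 ht ht1 sp
    have zr : (a0 * d1 - a1 * d0 : ℝ) = 0 := by exact_mod_cast z
    have Dr : (e0 * d1 - e1 * d0 : ℝ) = 0 := by exact_mod_cast hD'
    push_cast at q
    have pos : (d0 * d0 + d1 * d1 : ℝ) ≠ 0 := by
      intro hz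
      apply hd
      have hz' : d0 * d0 + d1 * d1 = 0 := by exact_mod_cast hz
      constructor <;> nlinarith [mul_self_nonneg d0, mul_self_nonneg d1]
    refine ⟨s', t', q1, q2, q3, q4, ?_, ?_⟩
    · apply (mul_eq_zero.mp (?_ : (d0 * d0 + d1 * d1 : ℝ) * _ = 0)).resolve_left pos
      linear_combination (d0 : ℝ) * q + d1 * zr - t' * d1 * Dr
    · apply (mul_eq_zero.mp (?_ : (d0 * d0 + d1 * d1 : ℝ) * _ = 0)).resolve_left pos
      linear_combination (d1 : ℝ) * q - d0 * zr + t' * d0 * Dr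
  · obtain ⟨s', _, q1, q2, _, _, q⟩ := aux_one _ _ _ s t hs hs1 ht ht1 se
    obtain ⟨_, t', _, _, q3, q4, r⟩ := aux_one _ _ _ s t hs hs1 ht ht1 sd
    push_cast at q r
    have Dr : (d0 * e1 - d1 * e0 : ℝ) ≠ 0 := by exact_mod_cast hD
    refine ⟨s', t', q1, q2, q3, q4, ?_, ?_⟩
    · apply (mul_eq_zero.mp (?_ : (d0 * e1 - d1 * e0 : ℝ) * _ = 0)).resolve_left Dr
      linear_combination (d0 : ℝ) * q - e0 * r
    · apply (mul_eq_zero.mp (?_ : (d0 * e1 - d1 * e0 : ℝ) * _ = 0)).resolve_left Dr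
      linear_combination (d1 : ℝ) * q - e1 * r

theorem aux_near (x a b : EuclideanSpace ℝ (Fin 2)) (c : ℝ)
    (h : Metric.infDist x (segment ℝ (c • a) (c • b)) ≤ 2) :
    ∃ s : ℝ, 0 ≤ s ∧ s ≤ 1 ∧ ∀ i, |x i - c * (a i + s * (b i - a i))| ≤ 2 := by
  have hc : IsCompact (segment ℝ (c • a) (c • b)) := by
    rw [segment_eq_image_lineMap]
    exact isCompact_Icc.image (AffineMap.lineMap_continuous)
  obtain ⟨p, hp, hd⟩ := hc.exists_infDist_eq_dist ⟨_, left_mem_segment ℝ _ _⟩ x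
  obtain ⟨r, s, hr, hs, hrs, rfl⟩ := hp
  refine ⟨s, hs, by linarith, fun i => ?_⟩
  rw [hd, dist_eq_norm] at h
  have := (PiLp.norm_apply_le _ i).trans h
  rw [Real.norm_eq_abs] at this
  obtain rfl : r = 1 - s := by linarith
  have e : (x - ((1 - s) • c • a + s • c • b)) i = x i - c * (a i + s * (b i - a i)) := by
    simp only [PiLp.sub_apply, PiLp.add_apply, PiLp.smul_apply, smul_eq_mul]
    ring
  rwa [e] at this

/-- Claim (iv) of Section 5 of the paper: the margins at distance 2 of two
scaled segments (scaled by `σ = 40n³`) whose unscaled versions are disjoint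
are themselves disjoint. -/
theorem stmt9 (n : ℕ) (hn : 3 ≤ n) (u v u' v' : EuclideanSpace ℝ (Fin 2))
    (hu : ∀ i, ∃ k : ℕ, k < n ∧ u i = k)
    (hv : ∀ i, ∃ k : ℕ, k < n ∧ v i = k)
    (hu' : ∀ i, ∃ k : ℕ, k < n ∧ u' i = k)
    (hv' : ∀ i, ∃ k : ℕ, k < n ∧ v' i = k)
    (h1 : u ≠ v) (h2 : u ≠ u') (h3 : u ≠ v') (h4 : v ≠ u') (h5 : v ≠ v')
    (h6 : u' ≠ v')
    (hdisj : segment ℝ u v ∩ segment ℝ u' v' = ∅) :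
    ¬ ∃ x : EuclideanSpace ℝ (Fin 2),
      Metric.infDist x
        (segment ℝ ((40 * (n : ℝ) ^ 3) • u) ((40 * (n : ℝ) ^ 3) • v)) ≤ 2 ∧
      Metric.infDist x
        (segment ℝ ((40 * (n : ℝ) ^ 3) • u') ((40 * (n : ℝ) ^ 3) • v')) ≤ 2 := by
  rintro ⟨x, hx, hx'⟩
  obtain ⟨s, s0, s1, hs⟩ := aux_near _ _ _ _ hx
  obtain ⟨t, t0, t1, ht⟩ := aux_near _ _ _ _ hx'
  choose U hU hU2 using hu
  choose V hV hV2 using hv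
  choose U' hU' hU2' using hu'
  choose V' hV' hV2' using hv'
  have hn' : (3 : ℝ) ≤ n := by exact_mod_cast hn
  have bd : ∀ a b : ℕ, a < n → b < n → |(((a : ℤ) - (b : ℤ) : ℤ) : ℝ)| ≤ n := by
    intro a b ha hb
    have ha' : (a : ℝ) < n := by exact_mod_cast ha
    have hb' : (b : ℝ) < n := by exact_mod_cast hb
    have := Nat.cast_nonneg (α := ℝ) a
    have := Nat.cast_nonneg (α := ℝ) b
    push_cast
    rw [abs_le]; constructor <;> linarith
  have hw : ∀ i, |(U i - U' i : ℝ) + s * (V i - U i) - t * (V' i - U' i)| * n < 1 / 2 := by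
    intro i
    have e1 := hs i
    have e2 := ht i
    rw [hU2, hV2] at e1
    rw [hU2', hV2'] at e2
    rw [abs_le] at e1 e2
    set W := (U i - U' i : ℝ) + s * (V i - U i) - t * (V' i - U' i) with hW
    have e3 : |40 * (n : ℝ) ^ 3 * W| ≤ 4 := by
      rw [abs_le]
      constructor <;> rw [hW] <;> nlinarith
    rw [abs_mul, abs_of_pos (by positivity)] at e3
    have e4 : (9 : ℝ) ≤ (n : ℝ) ^ 2 := by nlinarith
    have e5 : 0 ≤ |W| * n := by positivity
    nlinarith
  have ne : ∀ (p q : EuclideanSpace ℝ (Fin 2)) (P Q : Fin 2 → ℕ), (∀ i, p i = P i) →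
      (∀ i, q i = Q i) → p ≠ q → ¬ ((Q 0 : ℤ) - P 0 = 0 ∧ (Q 1 : ℤ) - P 1 = 0) := by
    rintro p q P Q hP hQ hpq ⟨g0, g1⟩
    apply hpq
    have g0' : P 0 = Q 0 := by omega
    have g1' : P 1 = Q 1 := by omega
    ext i
    fin_cases i
    · simp [hP, hQ, g0']
    · simp [hP, hQ, g1']
  obtain ⟨s', t', p1, p2, p3, p4, q0, q1⟩ := aux_core ((U 0 : ℤ) - U' 0) ((U 1 : ℤ) - U' 1)
    ((V 0 : ℤ) - U 0) ((V 1 : ℤ) - U 1) ((V' 0 : ℤ) - U' 0) ((V' 1 : ℤ) - U' 1) s t _ _ n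
    s0 s1 t0 t1 (bd _ _ (hV 0) (hU 0)) (bd _ _ (hV 1) (hU 1)) (bd _ _ (hV' 0) (hU' 0))
    (bd _ _ (hV' 1) (hU' 1)) (hw 0) (hw 1) (by push_cast; ring) (by push_cast; ring)
    (ne u v U V hU2 hV2 h1) (ne u' v' U' V' hU2' hV2' h6)
  push_cast at q0 q1
  have m1 : (1 - s') • u + s' • v ∈ segment ℝ u v :=
    ⟨1 - s', s', by linarith, p1, by ring, rfl⟩
  have m2 : (1 - s') • u + s' • v ∈ segment ℝ u' v' := by
    refine ⟨1 - t', t', by linarith, p3, by ring, ?_⟩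
    ext i
    fin_cases i
    · simp [hU2, hV2, hU2', hV2']
      linarith
    · simp [hU2, hV2, hU2', hV2']
      linarith
  have : (1 - s') • u + s' • v ∈ segment ℝ u v ∩ segment ℝ u' v' := ⟨m1, m2⟩
  rw [hdisj] at this
  exact this
end

section
/- Let G = (V, E) be a finite simple graph with n = |V| ≥ 3 vertices in which every vertex has degree at most 3. Suppose G admits a straight-line grid drawing: an injective map δ from V to points of ℝ² with integer coordinates in {0, 1, …, n−1} such that (a) for any two distinct edges {u, v} and {u', v'} of G, any point lying on both segments [δ(u), δ(v)] and [δ(u'), δ(v')] is of the form δ(w) for a vertex w belonging to both edges, and (b) for every edge {u, v} and every vertex w with w ∉ {u, v}, the point δ(w) does not lie on the segment [δ(u), δ(v)]. Then there exist integers r, s with 1 ≤ r ≤ 40n⁴ and 1 ≤ s ≤ 40n⁴ and a topological embedding of G into the (r, s)-wall W_{r,s}: an injective map f from V to the vertices of W_{r,s}, together with, for each edge {u, v} of G, a simple path in W_{r,s} from f(u) to f(v), such that for any two distinct edges of G the sets of inner vertices of the two corresponding paths are disjoint, and no inner vertex of any of these paths equals f(w) for any vertex w of G. -/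
/-- `(a, b)` is a vertex of the `(r, s)`-wall: `1 ≤ a ≤ r` and `1 ≤ b ≤ s`. -/
def wallRange (r s : ℤ) (a : ℤ × ℤ) : Prop :=
  1 ≤ a.1 ∧ a.1 ≤ r ∧ 1 ≤ a.2 ∧ a.2 ≤ s

/-- Base relation for the edges of the `(r, s)`-wall: horizontal edges
`(i, j) — (i, j+1)`, and vertical edges `(i, j) — (i + (−1)^(i+j), j)`,
restricted to pairs of wall vertices. -/
def wallRel (r s : ℤ) (a b : ℤ × ℤ) : Prop :=
  wallRange r s a ∧ wallRange r s b ∧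
    ((a.1 = b.1 ∧ b.2 = a.2 + 1) ∨
     (a.2 = b.2 ∧ b.1 = a.1 + (if Even (a.1 + a.2) then 1 else -1)))

/-- The `(r, s)`-wall graph (on ambient vertex type `ℤ × ℤ`; all edges join
wall vertices). -/
def wallGraph (r s : ℤ) : SimpleGraph (ℤ × ℤ) := SimpleGraph.fromRel (wallRel r s)

/-- The inner vertices of a walk: its support without the two endpoints. -/
def innerVerts {V : Type*} {G : SimpleGraph V} {a b : V} (w : G.Walk a b) :
    List V :=
  w.support.tail.dropLast

/-- `a` and `b` are joined by a walk of the wall staying in `S`. -/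
def Conn (r s : ℤ) (S : Set (ℤ × ℤ)) (a b : ℤ × ℤ) : Prop :=
  ∃ w : (wallGraph r s).Walk a b, ∀ x ∈ w.support, x ∈ S

theorem Conn.refl' {r s : ℤ} {S : Set (ℤ × ℤ)} {a : ℤ × ℤ} (h : a ∈ S) : Conn r s S a a :=
  ⟨.nil, by simpa using h⟩

theorem Conn.symm' {r s : ℤ} {S : Set (ℤ × ℤ)} {a b : ℤ × ℤ} (h : Conn r s S a b) :
    Conn r s S b a := by
  obtain ⟨w, hw⟩ := h
  exact ⟨w.reverse, by simpa using hw⟩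

theorem Conn.trans' {r s : ℤ} {S : Set (ℤ × ℤ)} {a b c : ℤ × ℤ} (h : Conn r s S a b)
    (h' : Conn r s S b c) : Conn r s S a c := by
  obtain ⟨w, hw⟩ := h
  obtain ⟨w', hw'⟩ := h'
  refine ⟨w.append w', fun x hx => ?_⟩
  rw [SimpleGraph.Walk.mem_support_append_iff] at hx
  exact hx.elim (hw x) (hw' x)

theorem Conn.mono' {r s : ℤ} {S T : Set (ℤ × ℤ)} {a b : ℤ × ℤ} (h : Conn r s S a b)
    (h' : S ⊆ T) : Conn r s T a b := by
  obtain ⟨w, hw⟩ := h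
  exact ⟨w, fun x hx => h' (hw x hx)⟩

theorem Conn.step' {r s : ℤ} {S : Set (ℤ × ℤ)} {a b : ℤ × ℤ} (h : wallRel r s a b)
    (hab : a ≠ b) (ha : a ∈ S) (hb : b ∈ S) : Conn r s S a b := by
  have hadj : (wallGraph r s).Adj a b := by
    rw [wallGraph, SimpleGraph.fromRel_adj]
    exact ⟨hab, Or.inl h⟩
  refine ⟨.cons hadj .nil, fun x hx => ?_⟩
  simp at hx
  rcases hx with rfl | rfl <;> assumption

theorem conn_row_aux {r s i j : ℤ} (hi : 1 ≤ i) (hi' : i ≤ r) (hj : 1 ≤ j) (k : ℕ)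
    (hk : j + k ≤ s) :
    Conn r s {x | x.1 = i ∧ j ≤ x.2 ∧ x.2 ≤ j + k} (i, j) (i, j + k) := by
  induction k with
  | zero => simpa using Conn.refl' (by simp)
  | succ k ih =>
    push_cast at hk ⊢
    refine Conn.trans' (Conn.mono' (ih (by omega)) ?_) (Conn.step' ?_ ?_ ?_ ?_)
    · rintro ⟨a, b⟩ h
      simp at h ⊢
      omega
    · refine ⟨?_, ?_, Or.inl ⟨rfl, ?_⟩⟩ <;> simp [wallRange] <;> omega
    · simp
    · simp
    · simp; omega

theorem conn_row {r s i j j' : ℤ} (hi : 1 ≤ i) (hi' : i ≤ r) (hj : 1 ≤ j) (hj' : 1 ≤ j')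
    (hs : j ≤ s) (hs' : j' ≤ s) :
    Conn r s {x | x.1 = i ∧ min j j' ≤ x.2 ∧ x.2 ≤ max j j'} (i, j) (i, j') := by
  rcases le_total j j' with h | h
  · obtain ⟨k, rfl⟩ := Int.le.dest h
    rw [min_eq_left h, max_eq_right h]
    exact conn_row_aux hi hi' hj k hs'
  · obtain ⟨k, rfl⟩ := Int.le.dest h
    rw [min_eq_right h, max_eq_left h]
    exact (conn_row_aux hi hi' hj' k hs).symm'

/-- In row `i`, the cell of the double column `c` that has an upward edge. -/
def upPort (i c : ℤ) : ℤ := if Even (i + 1) then 2 * c + 1 else 2 * c + 2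

/-- In row `i`, the cell of the double column `c` that has a downward edge. -/
def downPort (i c : ℤ) : ℤ := if Even (i + 1) then 2 * c + 2 else 2 * c + 1

theorem downPort_succ (i c : ℤ) : downPort (i + 1) c = upPort i c := by
  unfold downPort upPort
  have := Int.even_add_one (n := i + 1)
  by_cases h : Even (i + 1) <;> simp [h, this]

theorem upPort_even (i c : ℤ) : Even (i + upPort i c) := by
  unfold upPort
  split_ifs with h <;> rw [Int.even_iff] at * <;> omega

theorem upPort_or (i c : ℤ) : upPort i c = 2 * c + 1 ∨ upPort i c = 2 * c + 2 := by
  unfold upPort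
  split_ifs <;> simp

theorem downPort_or (i c : ℤ) : downPort i c = 2 * c + 1 ∨ downPort i c = 2 * c + 2 := by
  unfold downPort
  split_ifs <;> simp

theorem conn_zig {r s i c : ℤ} (hi : 1 ≤ i) (hc : 0 ≤ c) (hs : 2 * c + 2 ≤ s) (k : ℕ)
    (hk : i + k + 1 ≤ r) :
    Conn r s {x | (x.1 = i ∧ x.2 = upPort i c) ∨ (i < x.1 ∧ x.1 < i + k + 1 ∧
      (x.2 = 2 * c + 1 ∨ x.2 = 2 * c + 2)) ∨
      (x.1 = i + k + 1 ∧ x.2 = downPort (i + k + 1) c)}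
      (i, upPort i c) (i + k + 1, downPort (i + k + 1) c) := by
  have key : ∀ i' : ℤ, 1 ≤ i' → i' + 1 ≤ r →
      wallRel r s (i', upPort i' c) (i' + 1, downPort (i' + 1) c) := by
    intro i' h1 h2
    have := upPort_or i' c
    rw [downPort_succ]
    refine ⟨?_, ?_, Or.inr ⟨rfl, ?_⟩⟩
    · simp [wallRange]; omega
    · simp [wallRange]; omega
    · simp [upPort_even]
  induction k with
  | zero =>
    refine Conn.step' ?_ ?_ ?_ ?_
    · simpa using key i hi (by simpa using hk)
    · simp
    · simp
    · simp
  | succ k ih =>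
    push_cast at hk ⊢
    have e : i + (k + 1 : ℤ) + 1 = (i + k + 1) + 1 := by ring
    rw [e]
    generalize hm : i + (k : ℤ) + 1 = m at *
    have hm' : i < m := by omega
    refine Conn.trans' (Conn.mono' (ih (by omega)) ?_)
      (Conn.trans' (b := (m, upPort m c)) ?_ (Conn.step' (key m (by omega) (by omega)) ?_ ?_ ?_))
    · rintro ⟨a, b⟩ h
      simp at h ⊢
      have := downPort_or m c
      rcases h with h | h | ⟨rfl, rfl⟩ 
      · exact Or.inl h
      · right; left; omega
      · right; left; omega
    · have h1 := downPort_or m c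
      have h2 := upPort_or m c
      refine Conn.mono' (conn_row (by omega) (by omega) (by omega) (by omega) (by omega)
        (by omega)) ?_
      rintro ⟨a, b⟩ h
      simp at h ⊢
      right; left
      omega
    · simp
    · have h2 := upPort_or m c
      simp; omega
    · simp

theorem mem_inner {V : Type*} {G : SimpleGraph V} {a b : V} (w : G.Walk a b) (hw : w.IsPath)
    {x : V} (hx : x ∈ innerVerts w) : x ∈ w.support ∧ x ≠ a ∧ x ≠ b := by
  have hnd := hw.support_nodup
  unfold innerVerts at hx
  have h1 := List.mem_of_mem_dropLast hx
  have h2 := List.mem_of_mem_tail h1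
  refine ⟨h2, ?_, ?_⟩
  · rintro rfl
    rw [← SimpleGraph.Walk.cons_tail_support] at hnd
    exact (List.nodup_cons.1 hnd).1 h1
  · rintro rfl
    have hne : w.support.tail ≠ [] := List.ne_nil_of_mem h1
    have hl : w.support.tail.getLast hne = x := by
      rw [List.getLast_tail]; simp
    have h3 := List.dropLast_append_getLast hne
    have h4 : w.support.tail.Nodup := hnd.tail
    rw [← h3, List.nodup_append] at h4
    exact h4.2.2 x hx _ (by simp) hl.symm

theorem exists_median (T : Finset ℕ) (hT : T.Nonempty) (h3 : T.card ≤ 3) :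
    ∃ m ∈ T, ∀ a ∈ T, ∀ b ∈ T, a ≠ b → ¬ (a < m ∧ b < m) ∧ ¬ (m < a ∧ m < b) := by
  have h0 : 0 < T.card := hT.card_pos
  have hc : T.card = 1 ∨ T.card = 2 ∨ T.card = 3 := by omega
  rcases hc with h | h | h
  · obtain ⟨x, rfl⟩ := Finset.card_eq_one.1 h
    refine ⟨x, by simp, ?_⟩
    simp
  · obtain ⟨x, y, hxy, rfl⟩ := Finset.card_eq_two.1 h
    refine ⟨x, by simp, ?_⟩
    simp only [Finset.mem_insert, Finset.mem_singleton]
    omega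
  · obtain ⟨x, y, z, hxy, hxz, hyz, rfl⟩ := Finset.card_eq_three.1 h
    simp only [Finset.mem_insert, Finset.mem_singleton]
    have : (x < y ∧ y < z ∨ z < y ∧ y < x) ∨ (y < x ∧ x < z ∨ z < x ∧ x < y) ∨
      (x < z ∧ z < y ∨ y < z ∧ z < x) := by omega
    rcases this with h | h | h
    · exact ⟨y, by simp, by omega⟩
    · exact ⟨x, by simp, by omega⟩
    · exact ⟨z, by simp, by omega⟩

/-- Combinatorial part: a bar/column representation embeds into a wall. -/
theorem comb_part {V : Type} [Fintype V] (G : SimpleGraph V)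
    (hdeg : ∀ v : V, (G.neighborSet v).ncard ≤ 3) (N : ℕ)
    (L : V → ℕ) (hL : Function.Injective L) (hLN : ∀ v, L v < N)
    (col : V → V → ℕ) (hsymm : ∀ u v, G.Adj u v → col u v = col v u)
    (hcol : ∀ u v, G.Adj u v → 1 ≤ col u v ∧ col u v ≤ N)
    (hcinj : ∀ u v u' v', G.Adj u v → G.Adj u' v' → col u v = col u' v' →
      s(u, v) = s(u', v'))
    (hbar : ∀ u v w, G.Adj u v → L u < L w → L w < L v →
      (∀ z, G.Adj w z → col u v < col w z) ∨ (∀ z, G.Adj w z → col w z < col u v)) :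
    ∃ f : V → ℤ × ℤ,
        (∀ v : V, wallRange N (2 * N + 2) (f v)) ∧
        Function.Injective f ∧
        ∃ P : ∀ u v : V, G.Adj u v → (wallGraph N (2 * N + 2)).Walk (f u) (f v),
          (∀ u v (h : G.Adj u v), (P u v h).IsPath) ∧
          (∀ u v (h : G.Adj u v), P v u h.symm = (P u v h).reverse) ∧
          (∀ u v u' v' (h : G.Adj u v) (h' : G.Adj u' v'),
            s(u, v) ≠ s(u', v') →
            ∀ x : ℤ × ℤ,
              x ∈ innerVerts (P u v h) → x ∉ innerVerts (P u' v' h')) ∧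
          (∀ u v (h : G.Adj u v) (w : V), f w ∉ innerVerts (P u v h)) := by
  classical
  -- median neighbours
  have hmed : ∀ w, ∃ m, (∃ z, G.Adj w z) → G.Adj w m ∧ ∀ a b, G.Adj w a → G.Adj w b → a ≠ b →
      ¬ (col w a < col w m ∧ col w b < col w m) ∧
      ¬ (col w m < col w a ∧ col w m < col w b) := by
    intro w
    by_cases hz : ∃ z, G.Adj w z
    · obtain ⟨z, hz⟩ := hz
      obtain ⟨m, hm, hm'⟩ := exists_median ((G.neighborFinset w).image (col w))
        ⟨_, Finset.mem_image_of_mem _ ((G.mem_neighborFinset w z).2 hz)⟩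
        (Finset.card_image_le.trans (by
          have := hdeg w
          rwa [← SimpleGraph.coe_neighborFinset, Set.ncard_coe_finset] at this))
      obtain ⟨m, hm1, rfl⟩ := Finset.mem_image.1 hm
      refine ⟨m, fun _ => ⟨by simpa using hm1, fun a b ha hb hab => ?_⟩⟩
      refine hm' _ (Finset.mem_image_of_mem _ (by simpa using ha)) _
        (Finset.mem_image_of_mem _ (by simpa using hb)) fun h => hab ?_
      have := hcinj _ _ _ _ ha hb h
      rwa [Sym2.congr_right] at this
    · exact ⟨w, fun h => (hz h).elim⟩
  choose med hmed using hmed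
  let R : V → ℤ := fun v => L v + 1
  have hR : ∀ v, R v = L v + 1 := fun _ => rfl
  let p : V → V → ℤ := fun w v =>
    if L w < L v then upPort (R w) (col w v) else downPort (R w) (col w v)
  have hp : ∀ w v, p w v = 2 * col w v + 1 ∨ p w v = 2 * col w v + 2 := by
    intro w v
    simp only [p]
    split_ifs
    · exact upPort_or _ _
    · exact downPort_or _ _
  let g : V → ℤ := fun w => if ∃ z, G.Adj w z then p w (med w) else 1
  have hg : ∀ w z, G.Adj w z → g w = p w (med w) := fun w z h => if_pos ⟨z, h⟩
  have hg' : ∀ w, (¬ ∃ z, G.Adj w z) → g w = 1 := fun w h => if_neg h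
  have hRinj : ∀ u v, R u = R v → u = v := by
    intro u v h
    apply hL
    simp only [hR] at h
    omega
  let f : V → ℤ × ℤ := fun w => (R w, g w)
  let S : V → V → Set (ℤ × ℤ) := fun u v => {x |
    (x.1 = R u ∧ min (g u) (p u v) ≤ x.2 ∧ x.2 ≤ max (g u) (p u v)) ∨
    (x.1 = R v ∧ min (g v) (p v u) ≤ x.2 ∧ x.2 ≤ max (g v) (p v u)) ∨
    ((R u < x.1 ∧ x.1 < R v ∨ R v < x.1 ∧ x.1 < R u) ∧
      (x.2 = 2 * col u v + 1 ∨ x.2 = 2 * col u v + 2))}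
  have hRr : ∀ v, 1 ≤ R v ∧ R v ≤ N := by
    intro v
    have := hLN v
    simp only [hR]
    omega
  have hpr : ∀ u v, G.Adj u v → 1 ≤ p u v ∧ p u v ≤ 2 * N + 2 := by
    intro u v h
    have := hcol u v h
    have := hp u v
    omega
  have hgr : ∀ v, 1 ≤ g v ∧ g v ≤ 2 * N + 2 := by
    intro v
    by_cases h : ∃ z, G.Adj v z
    · rw [hg v _ h.choose_spec]
      exact hpr _ _ (hmed v h).1
    · rw [hg' v h]
      omega
  have hconn : ∀ u v, G.Adj u v → L u < L v → Conn N (2 * N + 2) (S u v) (f u) (f v) := by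
    intro u v h hlt
    obtain ⟨k, hk⟩ := Nat.exists_eq_add_of_lt hlt
    have hk' : R v = R u + k + 1 := by simp only [hR]; omega
    have e1 : p u v = upPort (R u) (col u v) := if_pos hlt
    have e2 : p v u = downPort (R v) (col u v) := by
      rw [hsymm u v h]
      exact if_neg (by omega)
    have c1 := conn_row (r := N) (s := 2 * N + 2) (hRr u).1 (hRr u).2 (hgr u).1 (hpr u v h).1
      (hgr u).2 (hpr u v h).2
    have c2 := conn_row (r := N) (s := 2 * N + 2) (hRr v).1 (hRr v).2 (hgr v).1
      (hpr v u h.symm).1 (hgr v).2 (hpr v u h.symm).2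
    have c3 := conn_zig (r := N) (s := 2 * N + 2) (c := col u v) (hRr u).1 (by omega)
      (by have := hcol u v h; omega) k (by have := hRr v; omega)
    rw [← hk', ← e1, ← e2] at c3
    refine Conn.trans' (Conn.mono' c1 ?_) (Conn.trans' (Conn.mono' c3 ?_)
      (Conn.mono' c2 ?_).symm')
    · intro x hx
      exact Or.inl hx
    · rintro ⟨a, b⟩ (hx | hx | hx)
      · left
        simp at hx
        simp [hx]
      · right; right
        exact ⟨Or.inl ⟨hx.1, hx.2.1⟩, hx.2.2⟩
      · right; left
        simp at hx
        simp [hx]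
    · intro x hx
      exact Or.inr (Or.inl hx)
  have hQ : ∀ u v, ∃ Q : G.Adj u v → L u < L v → (wallGraph N (2 * N + 2)).Walk (f u) (f v),
      ∀ h h', (Q h h').IsPath ∧ ∀ x ∈ (Q h h').support, x ∈ S u v := by
    intro u v
    by_cases h : G.Adj u v ∧ L u < L v
    · obtain ⟨w, hw⟩ := hconn u v h.1 h.2
      exact ⟨fun _ _ => w.bypass, fun _ _ => ⟨w.bypass_isPath, fun x hx =>
        hw x (w.support_bypass_subset_support hx)⟩⟩
    · exact ⟨fun h1 h2 => (h ⟨h1, h2⟩).elim, fun h1 h2 => (h ⟨h1, h2⟩).elim⟩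
  choose Q hQ using hQ
  have hne : ∀ {u v}, G.Adj u v → ¬ L u < L v → L v < L u := by
    intro u v h h'
    have : L u ≠ L v := fun e => h.ne (hL e)
    omega
  have hSsymm : ∀ u v, G.Adj u v → S u v ⊆ S v u := by
    intro u v h x hx
    simp only [S, Set.mem_ofPred_eq] at hx ⊢
    rw [hsymm v u h.symm]
    tauto
  let P : ∀ u v : V, G.Adj u v → (wallGraph N (2 * N + 2)).Walk (f u) (f v) := fun u v h =>
    if h' : L u < L v then Q u v h h' else (Q v u h.symm (hne h h')).reverse
  have hP : ∀ u v (h : G.Adj u v), (P u v h).IsPath ∧ ∀ x ∈ (P u v h).support, x ∈ S u v := by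
    intro u v h
    simp only [P]
    split_ifs with h'
    · exact hQ u v h h'
    · refine ⟨(hQ v u h.symm (hne h h')).1.reverse, fun x hx => ?_⟩
      rw [SimpleGraph.Walk.support_reverse, List.mem_reverse] at hx
      exact hSsymm _ _ h.symm ((hQ v u h.symm (hne h h')).2 x hx)
  have hin : ∀ u v (h : G.Adj u v) x, x ∈ innerVerts (P u v h) →
      x ∈ S u v ∧ x ≠ f u ∧ x ≠ f v := by
    intro u v h x hx
    obtain ⟨h1, h2⟩ := mem_inner _ (hP u v h).1 hx
    exact ⟨(hP u v h).2 x h1, h2⟩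
  have hbar' : ∀ u v w, G.Adj u v → (R u < R w ∧ R w < R v ∨ R v < R w ∧ R w < R u) →
      (∀ z, G.Adj w z → col u v < col w z) ∨ (∀ z, G.Adj w z → col w z < col u v) := by
    intro u v w h hw
    rcases hw with hw | hw
    · simp only [hR] at hw
      exact hbar u v w h (by omega) (by omega)
    · simp only [hR] at hw
      rw [hsymm u v h]
      exact hbar v u w h.symm (by omega) (by omega)
  -- a bar and the interior of a column
  have hHZ : ∀ u v u' v' (x : ℤ × ℤ), G.Adj u v → G.Adj u' v' →
      (x.1 = R u ∧ min (g u) (p u v) ≤ x.2 ∧ x.2 ≤ max (g u) (p u v)) →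
      ((R u' < x.1 ∧ x.1 < R v' ∨ R v' < x.1 ∧ x.1 < R u') ∧
      (x.2 = 2 * col u' v' + 1 ∨ x.2 = 2 * col u' v' + 2)) → False := by
    intro u v u' v' x h h' hx hx'
    have hm := (hmed u ⟨v, h⟩).1
    have p1 := hp u v
    have p2 := hp u (med u)
    rw [hg u v h, hx.1] at *
    rcases hbar' u' v' u h' hx'.1 with hb | hb
    · have := hb v h
      have := hb _ hm
      omega
    · have := hb v h
      have := hb _ hm
      omega
  -- two bars
  have hHH : ∀ u v u' v' (x : ℤ × ℤ), G.Adj u v → G.Adj u' v' → s(u, v) ≠ s(u', v') →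
      (x.1 = R u ∧ min (g u) (p u v) ≤ x.2 ∧ x.2 ≤ max (g u) (p u v)) →
      (x.1 = R u' ∧ min (g u') (p u' v') ≤ x.2 ∧ x.2 ≤ max (g u') (p u' v')) → x = f u := by
    intro u v u' v' x h h' hs hx hx'
    obtain rfl : u = u' := hRinj _ _ (hx.1.symm.trans hx'.1)
    have hvv : v ≠ v' := by rintro rfl; exact hs rfl
    have hm := hmed u ⟨v, h⟩
    have p1 := hp u v
    have p2 := hp u (med u)
    have p3 := hp u v'
    have k1 := hm.2 v v' h h' hvv
    have e1 : col u v = col u (med u) → p u v = p u (med u) := by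
      intro e
      have := hcinj _ _ _ _ h hm.1 e
      rw [Sym2.congr_right] at this
      rw [← this]
    have e2 : col u v' = col u (med u) → p u v' = p u (med u) := by
      intro e
      have := hcinj _ _ _ _ h' hm.1 e
      rw [Sym2.congr_right] at this
      rw [← this]
    have e3 : col u v ≠ col u v' := by
      intro e
      have := hcinj _ _ _ _ h h' e
      rw [Sym2.congr_right] at this
      exact hvv this
    have hx2 : x.2 = g u := by
      rw [hg u v h] at *
      obtain ⟨_, hxa, hxb⟩ := hx
      obtain ⟨_, hxc, hxd⟩ := hx'
      rcases lt_trichotomy (col u v) (col u (med u)) with a | a | a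
      · rcases lt_trichotomy (col u v') (col u (med u)) with b | b | b
        · omega
        · have := e2 b; omega
        · omega
      · have := e1 a; omega
      · rcases lt_trichotomy (col u v') (col u (med u)) with b | b | b
        · omega
        · have := e2 b; omega
        · omega
    exact Prod.ext hx.1 hx2
  refine ⟨f, fun v => ⟨(hRr v).1, (hRr v).2, hgr v⟩, ?_, P, fun u v h => (hP u v h).1, ?_, ?_, ?_⟩
  · intro u v h
    exact hRinj _ _ (congrArg Prod.fst h)
  · intro u v h
    by_cases h' : L u < L v
    · have h'' : ¬ L v < L u := by omega
      simp only [P, dif_pos h', dif_neg h'']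
    · have h'' : L v < L u := hne h h'
      simp only [P, dif_pos h'', dif_neg h', SimpleGraph.Walk.reverse_reverse]
  · intro u v u' v' h h' hs x hx hx'
    obtain ⟨hS, hu, hv⟩ := hin u v h x hx
    obtain ⟨hS', hu', hv'⟩ := hin u' v' h' x hx'
    have hs1 : s(v, u) ≠ s(u', v') := by rwa [Sym2.eq_swap]
    have hs2 : s(u, v) ≠ s(v', u') := by rwa [Sym2.eq_swap (a := v')]
    have hs3 : s(v, u) ≠ s(v', u') := by rwa [Sym2.eq_swap (a := v')]
    have sw : ∀ u v, G.Adj u v → ((R u < x.1 ∧ x.1 < R v ∨ R v < x.1 ∧ x.1 < R u) ∧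
      (x.2 = 2 * col u v + 1 ∨ x.2 = 2 * col u v + 2)) → 
      ((R v < x.1 ∧ x.1 < R u ∨ R u < x.1 ∧ x.1 < R v) ∧
      (x.2 = 2 * col v u + 1 ∨ x.2 = 2 * col v u + 2)) := by
      intro u v h hh
      rw [hsymm v u h.symm]
      tauto
    rcases hS with a | a | a <;> rcases hS' with b | b | b
    · exact hu (hHH _ _ _ _ x h h' hs a b)
    · exact hu (hHH _ _ _ _ x h h'.symm hs2 a b)
    · exact hHZ _ _ _ _ x h h' a b
    · exact hv (hHH _ _ _ _ x h.symm h' hs1 a b)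
    · exact hv (hHH _ _ _ _ x h.symm h'.symm hs3 a b)
    · exact hHZ _ _ _ _ x h.symm h' a b
    · exact hHZ _ _ _ _ x h' h b a
    · exact hHZ _ _ _ _ x h'.symm h b a
    · have : col u v = col u' v' := by omega
      exact hs (hcinj _ _ _ _ h h' this)
  · intro u v h w hw
    obtain ⟨hS, hu, hv⟩ := hin u v h _ hw
    rcases hS with a | a | a
    · exact hu (by rw [hRinj w u a.1])
    · exact hv (by rw [hRinj w v a.1])
    · by_cases hz : ∃ z, G.Adj w z
      · obtain ⟨z, hz⟩ := hz
        refine hHZ w z u v (f w) hz h ⟨rfl, ?_, ?_⟩ a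
        · exact min_le_left _ _
        · exact le_max_left _ _
      · have e : (f w).2 = 1 := hg' w hz
        have := hcol u v h
        omega

theorem exists_leftmost {E : Type*} (S : Finset E) (a b : E → ℕ) (hab : ∀ e ∈ S, a e < b e)
    (hS : S.Nonempty) (Y : E → ℕ → ℝ)
    (hne : ∀ e ∈ S, ∀ f ∈ S, e ≠ f → ∀ k, a e ≤ k → k < b e → a f ≤ k → k < b f →
      Y e k ≠ Y f k)
    (hcons : ∀ e ∈ S, ∀ f ∈ S, e ≠ f → ∀ k k', a e ≤ k → k < b e → a f ≤ k → k < b f →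
      a e ≤ k' → k' < b e → a f ≤ k' → k' < b f → Y e k < Y f k → Y e k' < Y f k') :
    ∃ e ∈ S, ∀ f ∈ S, f ≠ e → ∀ k, a e ≤ k → k < b e → a f ≤ k → k < b f → Y e k < Y f k := by
  classical
  have lm : ∀ e ∈ S, ∃ g ∈ S, a g ≤ a e ∧ a e < b g ∧
      ∀ f ∈ S, a f ≤ a e → a e < b f → Y g (a e) ≤ Y f (a e) := by
    intro e he
    obtain ⟨g, hg, hg'⟩ := Finset.exists_min_image
      (S.filter fun f => a f ≤ a e ∧ a e < b f) (fun f => Y f (a e))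
      ⟨e, by simp [he, hab e he]⟩
    simp only [Finset.mem_filter] at hg hg'
    exact ⟨g, hg.1, hg.2.1, hg.2.2, fun f h1 h2 h3 => hg' f ⟨h1, h2, h3⟩⟩
  let T := S.filter fun e => ∀ f ∈ S, a f ≤ a e → a e < b f → Y e (a e) ≤ Y f (a e)
  have hT : T.Nonempty := by
    obtain ⟨e, he, he'⟩ := Finset.exists_min_image S a hS
    obtain ⟨g, hg, h1, h2, h3⟩ := lm e he
    have : a g = a e := le_antisymm h1 (he' g hg)
    refine ⟨g, Finset.mem_filter.2 ⟨hg, ?_⟩⟩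
    rw [this]
    exact h3
  obtain ⟨e, he, hmax⟩ := Finset.exists_max_image T a hT
  obtain ⟨heS, heT⟩ := Finset.mem_filter.1 he
  refine ⟨e, heS, ?_⟩
  by_contra! hcon
  obtain ⟨f0, hf0, hfe0, k0, hk1, hk2, hk3, hk4, hk5⟩ := hcon
  let U := S.filter fun f => f ≠ e ∧ ∃ k, a e ≤ k ∧ k < b e ∧ a f ≤ k ∧ k < b f ∧ Y f k < Y e k
  have hU : U.Nonempty := ⟨f0, Finset.mem_filter.2 ⟨hf0, hfe0, k0, hk1, hk2, hk3, hk4,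
    lt_of_le_of_ne hk5 (hne _ hf0 _ heS hfe0 k0 hk3 hk4 hk1 hk2)⟩⟩
  have hUa : ∀ f ∈ U, a e < a f := by
    intro f hf
    obtain ⟨hfS, hfe, k, h1, h2, h3, h4, h5⟩ := Finset.mem_filter.1 hf
    by_contra! hle
    have := hcons f hfS e heS hfe k (a e) h3 h4 h1 h2 hle (by omega) le_rfl (hab e heS) h5
    have := heT f hfS hle (by omega)
    linarith
  obtain ⟨f, hf, hfmin⟩ := Finset.exists_min_image U a hU
  have haf := hUa f hf
  obtain ⟨hfS, hfe, k, h1, h2, h3, h4, h5⟩ := Finset.mem_filter.1 hf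
  have h6 := hcons f hfS e heS hfe k (a f) h3 h4 h1 h2 le_rfl (hab f hfS) (by omega) (by omega) h5
  obtain ⟨g, hg, g1, g2, g3⟩ := lm f hfS
  have h7 := g3 f hfS le_rfl (hab f hfS)
  have hge : g ≠ e := by
    rintro rfl
    linarith
  have hgU : g ∈ U := Finset.mem_filter.2 ⟨hg, hge, a f, by omega, by omega, g1, g2, by linarith⟩
  have hag : a g = a f := le_antisymm g1 (hfmin g hgU)
  have hgT : g ∈ T := by
    refine Finset.mem_filter.2 ⟨hg, ?_⟩
    rw [hag]
    exact g3
  have := hmax g hgT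
  omega

theorem exists_columns {E : Type*} (a b : E → ℕ) (Y : E → ℕ → ℝ) (m : ℕ) :
    ∀ (S : Finset E), S.card = m → (∀ e ∈ S, a e < b e) →
    (∀ e ∈ S, ∀ f ∈ S, e ≠ f → ∀ k, a e ≤ k → k < b e → a f ≤ k → k < b f →
      Y e k ≠ Y f k) →
    (∀ e ∈ S, ∀ f ∈ S, e ≠ f → ∀ k k', a e ≤ k → k < b e → a f ≤ k → k < b f →
      a e ≤ k' → k' < b e → a f ≤ k' → k' < b f → Y e k < Y f k → Y e k' < Y f k') →
    ∃ c : E → ℕ, (∀ e ∈ S, 1 ≤ c e ∧ c e ≤ m) ∧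
      (∀ e ∈ S, ∀ f ∈ S, c e = c f → e = f) ∧
      (∀ e ∈ S, ∀ f ∈ S, e ≠ f → ∀ k, a e ≤ k → k < b e → a f ≤ k → k < b f → Y e k < Y f k →
        c e < c f) := by
  classical
  induction m with
  | zero =>
    intro S hS _ _ _
    rw [Finset.card_eq_zero] at hS
    subst hS
    exact ⟨fun _ => 0, by simp, by simp, by simp⟩
  | succ m ih =>
    intro S hS hab hne hcons
    obtain ⟨e, he, hmin⟩ := exists_leftmost S a b hab (Finset.card_pos.1 (by omega)) Y hne hcons
    have sub : ∀ x ∈ S.erase e, x ∈ S := fun x hx => Finset.mem_of_mem_erase hx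
    obtain ⟨c, c1, c2, c3⟩ := ih (S.erase e) (by rw [Finset.card_erase_of_mem he]; omega)
      (fun x hx => hab x (sub x hx))
      (fun x hx y hy => hne x (sub x hx) y (sub y hy))
      (fun x hx y hy => hcons x (sub x hx) y (sub y hy))
    refine ⟨fun x => if x = e then 1 else c x + 1, ?_, ?_, ?_⟩
    · intro x hx
      by_cases h : x = e
      · simp [h]
      · have := c1 x (Finset.mem_erase.2 ⟨h, hx⟩)
        simp only [h, if_false]
        omega
    · intro x hx y hy hxy
      by_cases h : x = e <;> by_cases h' : y = e
      · rw [h, h']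
      · have := c1 y (Finset.mem_erase.2 ⟨h', hy⟩)
        simp only [h, h', if_false, if_true] at hxy
        omega
      · have := c1 x (Finset.mem_erase.2 ⟨h, hx⟩)
        simp only [h, h', if_false, if_true] at hxy
        omega
      · simp only [h, h', if_false] at hxy
        exact c2 x (Finset.mem_erase.2 ⟨h, hx⟩) y (Finset.mem_erase.2 ⟨h', hy⟩) (by omega)
    · intro x hx y hy hxy k k1 k2 k3 k4 hlt
      by_cases h : x = e <;> by_cases h' : y = e
      · exact (hxy (h.trans h'.symm)).elim
      · have := c1 y (Finset.mem_erase.2 ⟨h', hy⟩)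
        simp only [h, h', if_false, if_true]
        omega
      · subst h'
        have := hmin x hx h k k3 k4 k1 k2
        linarith
      · simp only [h, h', if_false]
        have := c3 x (Finset.mem_erase.2 ⟨h, hx⟩) y (Finset.mem_erase.2 ⟨h', hy⟩) hxy k k1 k2 k3 k4
          hlt
        omega

/-- Geometric part: a straight-line drawing gives a bar/column representation. -/
theorem geom_part {V : Type} [Fintype V] (G : SimpleGraph V) (n : ℕ) (hn : 0 < n)
    (hcard : Fintype.card V = n)
    (δ : V → EuclideanSpace ℝ (Fin 2))
    (hinj : Function.Injective δ)
    (hcoord : ∀ v : V, ∀ i, ∃ k : ℕ, k < n ∧ δ v i = k)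
    (hcross : ∀ u v u' v' : V, G.Adj u v → G.Adj u' v' →
      ¬ ((u = u' ∧ v = v') ∨ (u = v' ∧ v = u')) →
      ∀ x : EuclideanSpace ℝ (Fin 2),
        x ∈ segment ℝ (δ u) (δ v) → x ∈ segment ℝ (δ u') (δ v') →
        ∃ w : V, (w = u ∨ w = v) ∧ (w = u' ∨ w = v') ∧ x = δ w)
    (hthrough : ∀ u v w : V, G.Adj u v → w ≠ u → w ≠ v →
      δ w ∉ segment ℝ (δ u) (δ v)) :
    ∃ (L : V → ℕ) (col : V → V → ℕ), Function.Injective L ∧ (∀ v, L v < n ^ 2) ∧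
      (∀ u v, G.Adj u v → col u v = col v u) ∧
      (∀ u v, G.Adj u v → 1 ≤ col u v ∧ col u v ≤ n ^ 2) ∧
      (∀ u v u' v', G.Adj u v → G.Adj u' v' → col u v = col u' v' → s(u, v) = s(u', v')) ∧
      (∀ u v w, G.Adj u v → L u < L w → L w < L v →
        (∀ z, G.Adj w z → col u v < col w z) ∨ (∀ z, G.Adj w z → col w z < col u v)) := by
  classical
  choose q hq hδ using hcoord
  let L : V → ℕ := fun v => n * q v 1 + q v 0
  have hLdef : ∀ v, L v = n * q v 1 + q v 0 := fun _ => rfl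
  have hLr : ∀ v, (L v : ℝ) = n * q v 1 + q v 0 := fun v => by rw [hLdef]; push_cast; rfl
  have hLinj : Function.Injective L := by
    intro u v h
    have h0 : q u 0 = q v 0 := by
      have := congrArg (· % n) h
      simpa [hLdef, Nat.mod_eq_of_lt (hq _ _)] using this
    have h1 : q u 1 = q v 1 := by
      simp only [hLdef, h0, add_left_inj] at h
      exact Nat.eq_of_mul_eq_mul_left hn h
    apply hinj
    ext i
    fin_cases i
    · simp [hδ, h0]
    · simp [hδ, h1]
  have hLlt : ∀ v, L v < n ^ 2 := by
    intro v
    have h0 := hq v 0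
    have h1 := hq v 1
    rw [hLdef]
    nlinarith
  have hn' : (n : ℝ) ≠ 0 := by positivity
  let X : V × V → ℝ → ℝ := fun e t =>
    q e.1 0 + (t - L e.1) / (L e.2 - L e.1) * (q e.2 0 - q e.1 0)
  have hXc : ∀ e, Continuous (X e) := by
    intro e
    simp only [X]
    fun_prop
  have hX1 : ∀ e, X e (L e.1) = q e.1 0 := by
    intro e
    simp [X]
  have hX2 : ∀ e : V × V, L e.1 < L e.2 → X e (L e.2) = q e.2 0 := by
    intro e h
    have : (L e.2 : ℝ) - L e.1 ≠ 0 := by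
      have : (L e.1 : ℝ) < L e.2 := by exact_mod_cast h
      linarith
    simp only [X]
    rw [div_self this]
    ring
  let pt : ℝ → ℝ → EuclideanSpace ℝ (Fin 2) := fun x t => !₂[x, (t - x) / n]
  have hseg : ∀ (e : V × V) (t : ℝ), L e.1 < L e.2 → (L e.1 : ℝ) ≤ t → t ≤ L e.2 →
      pt (X e t) t ∈ segment ℝ (δ e.1) (δ e.2) := by
    intro e t h h1 h2
    have h' : (L e.1 : ℝ) < L e.2 := by exact_mod_cast h
    have hpos : (0 : ℝ) < L e.2 - L e.1 := by linarith
    rw [segment_eq_image]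
    have hX : X e t = q e.1 0 + (t - L e.1) / (L e.2 - L e.1) * (q e.2 0 - q e.1 0) := rfl
    have ht : t = L e.1 + (t - L e.1) / (L e.2 - L e.1) * (L e.2 - L e.1) := by
      field_simp
      ring
    have hθ0 : 0 ≤ (t - L e.1) / (L e.2 - L e.1) := div_nonneg (by linarith) hpos.le
    have hθ1 : (t - L e.1) / (L e.2 - L e.1) ≤ 1 := (div_le_one hpos).2 (by linarith)
    generalize (t - L e.1) / (L e.2 - L e.1) = θ at *
    refine ⟨θ, ⟨hθ0, hθ1⟩, ?_⟩
    ext i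
    fin_cases i
    · simp [pt, hδ, hX]
      ring
    · simp only [pt, hX]
      simp [hδ]
      rw [eq_div_iff hn', ht, hLr, hLr]
      ring
  have hpt : ∀ x t w, pt x t = δ w → t = L w ∧ x = q w 0 := by
    intro x t w h
    have h0 := congrArg (fun z => z 0) h
    have h1 := congrArg (fun z => z 1) h
    simp [pt, hδ] at h0 h1
    rw [div_eq_iff hn'] at h1
    refine ⟨?_, h0⟩
    rw [hLr, ← h0]
    linarith
  have hpt' : ∀ w, pt (q w 0) (L w) = δ w := by
    intro w
    ext i
    fin_cases i
    · simp [pt, hδ]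
    · simp [pt, hδ, hLr]
      field_simp
  let S : Finset (V × V) := Finset.univ.filter fun e => G.Adj e.1 e.2 ∧ L e.1 < L e.2
  have hS : ∀ e, e ∈ S ↔ G.Adj e.1 e.2 ∧ L e.1 < L e.2 := by simp [S]
  have hXne : ∀ e ∈ S, ∀ f ∈ S, e ≠ f → ∀ t : ℝ, (L e.1 : ℝ) < t → t < L e.2 → L f.1 ≤ t →
      t ≤ L f.2 → X e t ≠ X f t := by
    intro e he f hf hef t h1 h2 h3 h4 heq
    rw [hS] at he hf
    have s1 := hseg e t he.2 h1.le h2.le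
    have s2 := hseg f t hf.2 h3 h4
    rw [← heq] at s2
    obtain ⟨w, hw, -, hw'⟩ := hcross e.1 e.2 f.1 f.2 he.1 hf.1 (by
      rintro (⟨a, b⟩ | ⟨a, b⟩)
      · exact hef (Prod.ext a b)
      · have a1 := he.2
        have a2 := hf.2
        rw [a, b] at a1
        omega) _ s1 s2
    have := (hpt _ _ _ hw').1
    rcases hw with rfl | rfl <;> linarith
  have hXcons : ∀ e ∈ S, ∀ f ∈ S, e ≠ f → ∀ t t' : ℝ, (L e.1 : ℝ) < t → t < L e.2 → L f.1 ≤ t →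
      t ≤ L f.2 → (L e.1 : ℝ) < t' → t' < L e.2 → L f.1 ≤ t' → t' ≤ L f.2 →
      0 < (X e t - X f t) * (X e t' - X f t') := by
    intro e he f hf hef t t' h1 h2 h3 h4 h1' h2' h3' h4'
    by_contra! hcon
    have hivt := intermediate_value_uIcc (a := t) (b := t') (f := fun t => X e t - X f t)
      ((hXc e).sub (hXc f)).continuousOn
    have h0 : (0 : ℝ) ∈ Set.uIcc (X e t - X f t) (X e t' - X f t') := by
      rw [Set.mem_uIcc]
      rcases mul_nonpos_iff.1 hcon with h | h
      · right; exact ⟨h.2, h.1⟩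
      · left; exact h
    obtain ⟨z, hz, hz0⟩ := hivt h0
    rw [Set.mem_uIcc] at hz
    refine hXne e he f hf hef z ?_ ?_ ?_ ?_ (sub_eq_zero.1 hz0)
    all_goals rcases hz with hz | hz <;> linarith
  have half : ∀ (e : V × V) (k : ℕ), L e.1 ≤ k → k < L e.2 →
      (L e.1 : ℝ) < k + 1 / 2 ∧ (k + 1 / 2 : ℝ) < L e.2 := by
    intro e k h1 h2
    have h1' : (L e.1 : ℝ) ≤ k := by exact_mod_cast h1
    have h2' : (k + 1 : ℝ) ≤ L e.2 := by exact_mod_cast h2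
    constructor <;> linarith
  obtain ⟨c, c1, c2, c3⟩ := exists_columns (fun e : V × V => L e.1) (fun e => L e.2)
    (fun e k => X e (k + 1 / 2)) S.card S rfl (fun e he => ((hS e).1 he).2)
    (by
      intro e he f hf hef k k1 k2 k3 k4
      obtain ⟨a1, a2⟩ := half e k k1 k2
      obtain ⟨a3, a4⟩ := half f k k3 k4
      exact hXne e he f hf hef _ a1 a2 a3.le a4.le)
    (by
      intro e he f hf hef k k' k1 k2 k3 k4 k1' k2' k3' k4' hlt
      obtain ⟨a1, a2⟩ := half e k k1 k2
      obtain ⟨a3, a4⟩ := half f k k3 k4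
      obtain ⟨b1, b2⟩ := half e k' k1' k2'
      obtain ⟨b3, b4⟩ := half f k' k3' k4'
      have := hXcons e he f hf hef _ _ a1 a2 a3.le a4.le b1 b2 b3.le b4.le
      have := neg_of_mul_pos_right this (sub_neg.2 hlt).le
      exact sub_neg.1 this)
  have hScard : S.card ≤ n ^ 2 := by
    refine (Finset.card_le_univ S).trans ?_
    rw [Fintype.card_prod, hcard, sq]
  -- position of a column relative to a bar
  have hbar : ∀ e ∈ S, ∀ f ∈ S, ∀ w, (w = f.1 ∨ w = f.2) → L e.1 < L w → L w < L e.2 →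
      (X e (L w) < q w 0 → c e < c f) ∧ (q w 0 < X e (L w) → c f < c e) := by
    intro e he f hf w hw h1 h2
    have hef : e ≠ f := by
      rintro rfl
      rcases hw with rfl | rfl <;> omega
    have hf' := ((hS f).1 hf).2
    have hXf : X f (L w) = q w 0 := by
      rcases hw with rfl | rfl
      · exact hX1 f
      · exact hX2 f hf'
    have hk : ∃ k : ℕ, L e.1 ≤ k ∧ k < L e.2 ∧ L f.1 ≤ k ∧ k < L f.2 := by
      rcases hw with rfl | rfl
      · exact ⟨L f.1, by omega⟩
      · exact ⟨L f.2 - 1, by omega⟩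
    obtain ⟨k, k1, k2, k3, k4⟩ := hk
    obtain ⟨a1, a2⟩ := half e k k1 k2
    obtain ⟨a3, a4⟩ := half f k k3 k4
    have := hXcons e he f hf hef (L w) (k + 1 / 2) (by exact_mod_cast h1) (by exact_mod_cast h2)
      (by rcases hw with rfl | rfl <;> [exact le_rfl; exact_mod_cast hf'.le])
      (by rcases hw with rfl | rfl <;> [exact_mod_cast hf'.le; exact le_rfl])
      a1 a2 a3.le a4.le
    rw [hXf] at this
    constructor
    · intro hlt
      have := neg_of_mul_pos_right this (sub_neg.2 hlt).le
      exact c3 e he f hf hef k k1 k2 k3 k4 (sub_neg.1 this)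
    · intro hlt
      have := pos_of_mul_pos_right this (sub_pos.2 hlt).le
      exact c3 f hf e he hef.symm k k3 k4 k1 k2 (sub_pos.1 this)
  let o : V → V → V × V := fun u v => if L u < L v then (u, v) else (v, u)
  have hLne : ∀ u v, G.Adj u v → L u ≠ L v := fun u v h e => h.ne (hLinj e)
  have ho : ∀ u v, G.Adj u v → o u v ∈ S := by
    intro u v h
    have := hLne u v h
    simp only [o]
    split_ifs with h'
    · exact (hS _).2 ⟨h, h'⟩
    · exact (hS _).2 ⟨h.symm, by simp only; omega⟩
  have hos : ∀ u v, s((o u v).1, (o u v).2) = s(u, v) := by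
    intro u v
    simp only [o]
    split_ifs
    · rfl
    · exact Sym2.eq_swap
  have hom : ∀ u v, u = (o u v).1 ∨ u = (o u v).2 := by
    intro u v
    simp only [o]
    split_ifs <;> simp
  refine ⟨L, fun u v => c (o u v), hLinj, hLlt, ?_, ?_, ?_, ?_⟩
  · intro u v h
    have := hLne u v h
    have e : o u v = o v u := by
      simp only [o]
      split_ifs <;> first | rfl | omega
    simp only [e]
  · intro u v h
    have := c1 _ (ho u v h)
    exact ⟨this.1, this.2.trans hScard⟩
  · intro u v u' v' h h' e
    have := c2 _ (ho u v h) _ (ho u' v' h') e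
    rw [← hos u v, ← hos u' v', this]
  · intro u v w h h1 h2
    have hoe : o u v = (u, v) := if_pos (h1.trans h2)
    have hne : X (u, v) (L w) ≠ q w 0 := by
      intro heq
      refine hthrough u v w h (by rintro rfl; omega) (by rintro rfl; omega) ?_
      have := hseg (u, v) (L w) (h1.trans h2) (by exact_mod_cast h1.le) (by exact_mod_cast h2.le)
      rwa [heq, hpt'] at this
    have hb := fun z (hz : G.Adj w z) => hbar (o u v) (ho u v h) (o w z) (ho w z hz) w (hom w z)
      (by rw [hoe]; exact h1) (by rw [hoe]; exact h2)
    rw [← hoe] at hne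
    rcases lt_or_gt_of_ne hne with h' | h'
    · left
      exact fun z hz => (hb z hz).1 h'
    · right
      exact fun z hz => (hb z hz).2 h'

/-- Combinatorial core of Theorem 1 of the paper: a degree-3 graph on
`n ≥ 3` vertices admitting a non-crossing straight-line drawing on the
`{0, …, n−1}` grid embeds as a topological minor into an `(r, s)`-wall with
`r, s ≤ 40n⁴`. -/
theorem stmt11 {V : Type} [Fintype V] (G : SimpleGraph V)
    (hn : 3 ≤ Fintype.card V)
    (hdeg : ∀ v : V, (G.neighborSet v).ncard ≤ 3)
    (δ : V → EuclideanSpace ℝ (Fin 2))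
    (hinj : Function.Injective δ)
    (hcoord : ∀ v : V, ∀ i, ∃ k : ℕ, k < Fintype.card V ∧ δ v i = k)
    (hcross : ∀ u v u' v' : V, G.Adj u v → G.Adj u' v' →
      ¬ ((u = u' ∧ v = v') ∨ (u = v' ∧ v = u')) →
      ∀ x : EuclideanSpace ℝ (Fin 2),
        x ∈ segment ℝ (δ u) (δ v) → x ∈ segment ℝ (δ u') (δ v') →
        ∃ w : V, (w = u ∨ w = v) ∧ (w = u' ∨ w = v') ∧ x = δ w)
    (hthrough : ∀ u v w : V, G.Adj u v → w ≠ u → w ≠ v →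
      δ w ∉ segment ℝ (δ u) (δ v)) :
    ∃ r s : ℤ,
      1 ≤ r ∧ r ≤ 40 * (Fintype.card V : ℤ) ^ 4 ∧
      1 ≤ s ∧ s ≤ 40 * (Fintype.card V : ℤ) ^ 4 ∧
      ∃ f : V → ℤ × ℤ,
        (∀ v : V, wallRange r s (f v)) ∧
        Function.Injective f ∧
        ∃ P : ∀ u v : V, G.Adj u v → (wallGraph r s).Walk (f u) (f v),
          (∀ u v (h : G.Adj u v), (P u v h).IsPath) ∧
          (∀ u v (h : G.Adj u v), P v u h.symm = (P u v h).reverse) ∧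
          (∀ u v u' v' (h : G.Adj u v) (h' : G.Adj u' v'),
            s(u, v) ≠ s(u', v') →
            ∀ x : ℤ × ℤ,
              x ∈ innerVerts (P u v h) → x ∉ innerVerts (P u' v' h')) ∧
          (∀ u v (h : G.Adj u v) (w : V), f w ∉ innerVerts (P u v h)) := by
  obtain ⟨L, col, h1, h2, h3, h4, h5, h6⟩ := geom_part G (Fintype.card V) (by omega) rfl δ hinj
    hcoord hcross hthrough
  have key := comb_part G hdeg (Fintype.card V ^ 2) L h1 h2 col h3 h4 h5 h6
  have hc : (3 : ℤ) ≤ Fintype.card V := by exact_mod_cast hn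
  generalize Fintype.card V = n at *
  refine ⟨((n ^ 2 : ℕ) : ℤ), 2 * ((n ^ 2 : ℕ) : ℤ) + 2, ?_, ?_, ?_, ?_, key⟩
  all_goals
    push_cast
    have h9 : (9 : ℤ) ≤ (n : ℤ) ^ 2 := by nlinarith
    nlinarith
end
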